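/- Let G be an L⁰-convexly compact subset of L⁰(𝓕,B) that has random normal structure. Then every isometric mapping T : G → G has a fixed point belonging to the random Chebyshev center C(G,G). -/

import Mathlib

open MeasureTheory Set Filter Function
open scoped Classical

noncomputable section

namespace RNM


variable {Ω : Type*} [MeasurableSpace Ω] {P : Measure Ω}
variable {B : Type*} [NormedAddCommGroup B] [NormedSpace ℝ B]

/-- The pointwise norm of `x ∈ L⁰(𝓕,B)` as an element of `L⁰(𝓕,ℝ)`. -/
def nrm (x : Ω →ₘ[P] B) : Ω →ₘ[P] ℝ := x.comp norm continuous_norm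

/-- The module action of `L⁰(𝓕,ℝ)` on `L⁰(𝓕,B)` (pointwise scalar multiplication). -/
def msmul (l : Ω →ₘ[P] ℝ) (x : Ω →ₘ[P] B) : Ω →ₘ[P] B :=
  AEEqFun.comp₂ (fun c (b : B) => c • b) continuous_smul l x

/-- `Ĩ_A`, the equivalence class of the indicator function of `A`, in `L⁰(𝓕,ℝ)`. -/
def ind (A : Set Ω) (hA : MeasurableSet A) : Ω →ₘ[P] ℝ :=
  AEEqFun.mk (A.indicator fun _ => (1 : ℝ))
    ((measurable_const.indicator hA).aestronglyMeasurable)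

/-- A subset of `L⁰(𝓕,B)` is a.s. bounded if the norms of its members have a common
bound in `L⁰(𝓕,ℝ)`. -/
def ASBounded (H : Set (Ω →ₘ[P] B)) : Prop :=
  ∃ ξ : Ω →ₘ[P] ℝ, ∀ h ∈ H, nrm h ≤ ξ

/-- The supremum of a subset of `L⁰(𝓕,ℝ)` (junk value `0` if no least upper bound exists;
for nonempty a.s. bounded-above sets the least upper bound always exists, by Dedekind
completeness of `L⁰(𝓕,ℝ)`). -/
def lsup (S : Set (Ω →ₘ[P] ℝ)) : Ω →ₘ[P] ℝ :=
  if h : ∃ ξ, IsLUB S ξ then h.choose else 0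

/-- The infimum of a subset of `L⁰(𝓕,ℝ)` (junk value `0` if no greatest lower bound exists). -/
def linf (S : Set (Ω →ₘ[P] ℝ)) : Ω →ₘ[P] ℝ :=
  if h : ∃ ξ, IsGLB S ξ then h.choose else 0

/-- The random Chebyshev radius `R(H,x)` of `H` at `x`. -/
def Rr (H : Set (Ω →ₘ[P] B)) (x : Ω →ₘ[P] B) : Ω →ₘ[P] ℝ :=
  lsup ((fun y => nrm (x - y)) '' H)

/-- The random Chebyshev radius `R(H,G)` of `H` with respect to `G`. -/
def RrS (H G : Set (Ω →ₘ[P] B)) : Ω →ₘ[P] ℝ :=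
  linf ((fun x => Rr H x) '' G)

/-- The random Chebyshev center `C(H,G)` of `H` with respect to `G`. -/
def Cc (H G : Set (Ω →ₘ[P] B)) : Set (Ω →ₘ[P] B) :=
  {x ∈ G | Rr H x = RrS H G}

/-- The random diameter `D(H)`. -/
def Dd (H : Set (Ω →ₘ[P] B)) : Ω →ₘ[P] ℝ :=
  lsup {ξ | ∃ x ∈ H, ∃ y ∈ H, ξ = nrm (x - y)}

/-- A subset of `L⁰(𝓕,B)` is closed if it is sequentially closed under convergence in
probability (the `(ε,λ)`-topology). -/
def SeqClosed (S : Set (Ω →ₘ[P] B)) : Prop :=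
  ∀ (x : ℕ → Ω →ₘ[P] B) (y : Ω →ₘ[P] B), (∀ n, x n ∈ S) →
    TendstoInMeasure P (fun n => (x n : Ω → B)) atTop y → y ∈ S

/-- The closure of a subset of `L⁰(𝓕,B)` under convergence in probability. -/
def seqClosure (S : Set (Ω →ₘ[P] B)) : Set (Ω →ₘ[P] B) :=
  {y | ∃ x : ℕ → Ω →ₘ[P] B, (∀ n, x n ∈ S) ∧
    TendstoInMeasure P (fun n => (x n : Ω → B)) atTop y}

/-- `L⁰`-convexity. -/
def LConvex (G : Set (Ω →ₘ[P] B)) : Prop :=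
  ∀ x ∈ G, ∀ y ∈ G, ∀ l : Ω →ₘ[P] ℝ, 0 ≤ l → l ≤ 1 →
    msmul l x + msmul (1 - l) y ∈ G

/-- `L⁰`-convex compactness: `G` is a nonempty closed `L⁰`-convex set such that every family
of nonempty closed `L⁰`-convex subsets of `G` with the finite intersection property has
nonempty intersection. -/
def ConvexlyCompact (G : Set (Ω →ₘ[P] B)) : Prop :=
  G.Nonempty ∧ SeqClosed G ∧ LConvex G ∧
    ∀ 𝒞 : Set (Set (Ω →ₘ[P] B)),
      (∀ C ∈ 𝒞, C.Nonempty ∧ C ⊆ G ∧ SeqClosed C ∧ LConvex C) →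
      (∀ S : Finset (Set (Ω →ₘ[P] B)), ↑S ⊆ 𝒞 → (⋂₀ (S : Set (Set (Ω →ₘ[P] B)))).Nonempty) →
      (⋂₀ 𝒞).Nonempty

/-- Random normal structure. -/
def RandNormalStructure (G : Set (Ω →ₘ[P] B)) : Prop :=
  ∀ H ⊆ G, H.Nonempty → ASBounded H → SeqClosed H → LConvex H → Dd H ≠ 0 →
    ∃ z ∈ H, ∀ᵐ ω ∂P, 0 < Dd H ω → Rr H z ω < Dd H ω

/-- A nonexpansive mapping (on `G`). -/
def NonexpansiveOn (G : Set (Ω →ₘ[P] B)) (T : (Ω →ₘ[P] B) → (Ω →ₘ[P] B)) : Prop :=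
  ∀ x ∈ G, ∀ y ∈ G, nrm (T x - T y) ≤ nrm (x - y)

/-- An isometric mapping (on `G`). -/
def IsometricOn (G : Set (Ω →ₘ[P] B)) (T : (Ω →ₘ[P] B) → (Ω →ₘ[P] B)) : Prop :=
  ∀ x ∈ G, ∀ y ∈ G, nrm (T x - T y) = nrm (x - y)

/-- A countable measurable partition of `Ω`. -/
def IsPartition (A : ℕ → Set Ω) : Prop :=
  (∀ n, MeasurableSet (A n)) ∧ Pairwise (Disjoint on A) ∧ (⋃ n, A n) = univ

/-- `y` is the countable concatenation `Σ_n Ĩ_{A_n} x_n`,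
i.e. `y` agrees a.s. with `x n` on `A n` for each `n`. -/
def IsConcat (A : ℕ → Set Ω) (x : ℕ → Ω →ₘ[P] B) (y : Ω →ₘ[P] B) : Prop :=
  ∀ n, ∀ᵐ ω ∂P, ω ∈ A n → y ω = x n ω

/-- `G` is σ-stable: it contains all countable concatenations of its members along
countable measurable partitions of `Ω`. -/
def SigmaStable (G : Set (Ω →ₘ[P] B)) : Prop :=
  ∀ A : ℕ → Set Ω, IsPartition A → ∀ x : ℕ → Ω →ₘ[P] B, (∀ n, x n ∈ G) →
    ∀ y, IsConcat A x y → y ∈ G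

/-- The σ-stable hull of `G`. -/
def sigmaHull (G : Set (Ω →ₘ[P] B)) : Set (Ω →ₘ[P] B) :=
  {y | ∃ A : ℕ → Set Ω, IsPartition A ∧
    ∃ x : ℕ → Ω →ₘ[P] B, (∀ n, x n ∈ G) ∧ IsConcat A x y}

/-- The countable concatenation `Σ_n Ĩ_{A_n} H_n` of a sequence of sets. -/
def concatSet (A : ℕ → Set Ω) (H : ℕ → Set (Ω →ₘ[P] B)) : Set (Ω →ₘ[P] B) :=
  {y | ∃ x : ℕ → Ω →ₘ[P] B, (∀ n, x n ∈ H n) ∧ IsConcat A x y}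

/-- A finitely stable subset of `L⁰(𝓕,B)`. -/
def FinStable (G : Set (Ω →ₘ[P] B)) : Prop :=
  ∀ x ∈ G, ∀ y ∈ G, ∀ A : Set Ω, ∀ hA : MeasurableSet A,
    msmul (ind A hA) x + msmul (ind Aᶜ hA.compl) y ∈ G


theorem nrm_sub_coe (x y : Ω →ₘ[P] B) : ∀ᵐ ω ∂P, nrm (x - y) ω = ‖x ω - y ω‖ := by
  filter_upwards [AEEqFun.coeFn_comp norm continuous_norm (x - y), AEEqFun.coeFn_sub x y]
    with ω h1 h2
  rw [nrm, h1]; simp [h2]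

theorem nrm_coe (x : Ω →ₘ[P] B) : ∀ᵐ ω ∂P, nrm x ω = ‖x ω‖ := by
  filter_upwards [AEEqFun.coeFn_comp norm continuous_norm x] with ω h1
  rw [nrm, h1]; rfl

theorem nrm_sub_le_iff (x y : Ω →ₘ[P] B) (r : Ω →ₘ[P] ℝ) :
    nrm (x - y) ≤ r ↔ ∀ᵐ ω ∂P, ‖x ω - y ω‖ ≤ r ω := by
  rw [← AEEqFun.coeFn_le]
  constructor
  · intro h
    filter_upwards [h, nrm_sub_coe x y] with ω h1 h2
    rwa [← h2]
  · intro h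
    filter_upwards [h, nrm_sub_coe x y] with ω h1 h2
    rwa [h2]

theorem comb_coe (l : Ω →ₘ[P] ℝ) (x y : Ω →ₘ[P] B) :
    ∀ᵐ ω ∂P, (msmul l x + msmul (1 - l) y : Ω →ₘ[P] B) ω = l ω • x ω + (1 - l ω) • y ω := by
  filter_upwards [AEEqFun.coeFn_add (msmul l x) (msmul (1 - l) y),
    AEEqFun.coeFn_comp₂ (fun c (b : B) => c • b) continuous_smul l x,
    AEEqFun.coeFn_comp₂ (fun c (b : B) => c • b) continuous_smul (1 - l) y,
    AEEqFun.coeFn_sub (1 : Ω →ₘ[P] ℝ) l, AEEqFun.coeFn_one (α := Ω) (μ := P) (β := ℝ)]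
    with ω h1 h2 h3 h4 h5
  rw [h1, Pi.add_apply, msmul, msmul, h2, h3, h4, Pi.sub_apply, h5]
  rfl

/-- A set cut out by pointwise closed convex constraints is closed and `L⁰`-convex. -/
theorem constraint_closed_convex {ι : Type*} {G : Set (Ω →ₘ[P] B)} (hc : SeqClosed G)
    (hv : LConvex G) (K : ι → Ω → Set B) (hKc : ∀ i ω, IsClosed (K i ω))
    (hKv : ∀ i ω, Convex ℝ (K i ω)) :
    SeqClosed {x ∈ G | ∀ i, ∀ᵐ ω ∂P, x ω ∈ K i ω} ∧
    LConvex {x ∈ G | ∀ i, ∀ᵐ ω ∂P, x ω ∈ K i ω} := by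
  constructor
  · intro x y hx hxy
    refine ⟨hc x y (fun n => (hx n).1) hxy, fun i => ?_⟩
    obtain ⟨ns, -, h⟩ := hxy.exists_seq_tendsto_ae
    have h2 : ∀ᵐ ω ∂P, ∀ n, x n ω ∈ K i ω := ae_all_iff.2 fun n => (hx n).2 i
    filter_upwards [h, h2] with ω h h2
    exact (hKc i ω).mem_of_tendsto h (Eventually.of_forall fun n => h2 _)
  · intro x hx y hy l h0 h1
    refine ⟨hv x hx.1 y hy.1 l h0 h1, fun i => ?_⟩
    filter_upwards [comb_coe l x y, hx.2 i, hy.2 i, AEEqFun.coeFn_le.2 h0, AEEqFun.coeFn_le.2 h1,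
      AEEqFun.coeFn_one (α := Ω) (μ := P) (β := ℝ), AEEqFun.coeFn_zero (α := Ω) (μ := P) (β := ℝ)]
      with ω e hx hy h0 h1 e1 e0
    rw [e]
    rw [e0] at h0
    rw [e1] at h1
    exact hKv i ω hx hy h0 (sub_nonneg.2 h1) (by ring)

theorem two_concat {G : Set (Ω →ₘ[P] B)} (hv : LConvex G) {x y : Ω →ₘ[P] B} (hx : x ∈ G)
    (hy : y ∈ G) {A : Set Ω} (hA : MeasurableSet A) :
    ∃ z ∈ G, ∀ᵐ ω ∂P, (ω ∈ A → z ω = x ω) ∧ (ω ∉ A → z ω = y ω) := by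
  have hi : ∀ᵐ ω ∂P, (ind A hA : Ω →ₘ[P] ℝ) ω = A.indicator (fun _ => (1 : ℝ)) ω :=
    AEEqFun.coeFn_mk _ _
  refine ⟨_, hv x hx y hy (ind A hA) ?_ ?_, ?_⟩
  · rw [← AEEqFun.coeFn_le]
    filter_upwards [hi, AEEqFun.coeFn_zero (α := Ω) (μ := P) (β := ℝ)] with ω h h0
    rw [h, h0]
    exact indicator_nonneg (fun _ _ => zero_le_one) _
  · rw [← AEEqFun.coeFn_le]
    filter_upwards [hi, AEEqFun.coeFn_one (α := Ω) (μ := P) (β := ℝ)] with ω h h0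
    rw [h, h0]
    by_cases hω : ω ∈ A <;> simp [hω]
  · filter_upwards [hi, comb_coe (ind A hA) x y] with ω h h2
    rw [h2, h]
    by_cases hω : ω ∈ A <;> simp [hω]

/-- Countable concatenation along a measurable index. -/
theorem nat_concat [IsProbabilityMeasure P] {G : Set (Ω →ₘ[P] B)} (hc : SeqClosed G)
    (hv : LConvex G) (x : ℕ → Ω →ₘ[P] B) (hx : ∀ n, x n ∈ G) (N : Ω → ℕ) (hN : Measurable N) :
    ∃ z ∈ G, ∀ᵐ ω ∂P, z ω = x (N ω) ω := by
  have hstep : ∀ (m : ℕ) (y : G), ∃ z : G, ∀ᵐ ω ∂P,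
      (N ω = m → z.1 ω = x m ω) ∧ (N ω ≠ m → z.1 ω = y.1 ω) := by
    intro m y
    obtain ⟨z, hz, h⟩ := two_concat hv (hx m) y.2 (hN (measurableSet_singleton m))
    exact ⟨⟨z, hz⟩, h⟩
  choose F hF using hstep
  let Y : ℕ → G := fun m => Nat.rec (⟨x 0, hx 0⟩ : G) (fun m y => F m y) m
  have hY : ∀ᵐ ω ∂P, ∀ m, (N ω = m → (Y (m+1)).1 ω = x m ω) ∧
      (N ω ≠ m → (Y (m+1)).1 ω = (Y m).1 ω) := ae_all_iff.2 fun m => hF m (Y m)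
  have hlim : ∀ᵐ ω ∂P, Tendsto (fun m => (Y m).1 ω) atTop (nhds (x (N ω) ω)) := by
    filter_upwards [hY] with ω h
    apply tendsto_const_nhds.congr'
    filter_upwards [eventually_ge_atTop (N ω + 1)] with m hm
    induction m, hm using Nat.le_induction with
    | base => exact ((h _).1 rfl).symm
    | succ m hm ih => rw [(h m).2 (by omega)]; exact ih
  have hmeas : AEStronglyMeasurable (fun ω => x (N ω) ω) P :=
    aestronglyMeasurable_of_tendsto_ae atTop (fun m => (Y m).1.aestronglyMeasurable) hlim
  have hmk := AEEqFun.coeFn_mk _ hmeas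
  refine ⟨AEEqFun.mk _ hmeas, hc (fun m => (Y m).1) _ (fun m => (Y m).2) ?_, hmk⟩
  apply tendstoInMeasure_of_tendsto_ae (fun m => (Y m).1.aestronglyMeasurable)
  filter_upwards [hlim, hmk] with ω h h2
  rwa [h2]

theorem select [IsProbabilityMeasure P] {G : Set (Ω →ₘ[P] B)} (hc : SeqClosed G)
    (hv : LConvex G) (x : ℕ → Ω →ₘ[P] B) (hx : ∀ n, x n ∈ G) (p : ℕ → Set Ω)
    (hp : ∀ n, MeasurableSet (p n)) :
    ∃ z ∈ G, ∀ᵐ ω ∂P, (∃ n, ω ∈ p n) → ∃ n, ω ∈ p n ∧ z ω = x n ω := by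
  have hex : ∀ ω, ∃ n, ω ∈ p n ∨ ω ∈ ⋂ m, (p m)ᶜ := by
    intro ω
    by_cases h : ∃ n, ω ∈ p n
    · obtain ⟨n, hn⟩ := h; exact ⟨n, Or.inl hn⟩
    · exact ⟨0, Or.inr (by simpa using h)⟩
  obtain ⟨z, hz, h⟩ := nat_concat hc hv x hx (fun ω => Nat.find (hex ω))
    (measurable_find hex fun k => (hp k).union (MeasurableSet.iInter fun m => (hp m).compl))
  refine ⟨z, hz, ?_⟩
  filter_upwards [h] with ω h hn
  refine ⟨_, ?_, h⟩
  rcases Nat.find_spec (hex ω) with h1 | h1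
  · exact h1
  · obtain ⟨n, hn⟩ := hn
    exact absurd hn (mem_iInter.1 h1 n)

/-- A countable subfamily with the same essential supremum. -/
theorem exists_seq_sup [IsProbabilityMeasure P] (S : Set (Ω →ₘ[P] ℝ)) (hS : S.Nonempty) :
    ∃ s : ℕ → Ω →ₘ[P] ℝ, (∀ n, s n ∈ S) ∧
      ∀ t ∈ S, ∀ᵐ ω ∂P, Real.arctan (t ω) ≤ ⨆ n, Real.arctan (s n ω) := by
  have : Nonempty S := hS.to_subtype
  let F : (ℕ → S) → Ω → ℝ := fun s ω => ⨆ n, Real.arctan ((s n).1 ω)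
  have hbdd : ∀ (s : ℕ → S) ω, BddAbove (range fun n => Real.arctan ((s n).1 ω)) := by
    intro s ω
    exact ⟨Real.pi / 2, by rintro _ ⟨n, rfl⟩; exact (Real.arctan_lt_pi_div_two _).le⟩
  have hF1 : ∀ s ω, F s ω ≤ Real.pi / 2 := fun s ω =>
    ciSup_le fun n => (Real.arctan_lt_pi_div_two _).le
  have hF2 : ∀ s ω, -(Real.pi / 2) ≤ F s ω := fun s ω =>
    (Real.neg_pi_div_two_lt_arctan _).le.trans (le_ciSup (hbdd s ω) 0)
  have hFi : ∀ s, Integrable (F s) P := by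
    intro s
    refine Integrable.of_bound (C := Real.pi / 2) ?_ (Eventually.of_forall fun ω => ?_)
    · exact (Measurable.iSup fun n =>
        Real.measurable_arctan.comp (s n).1.stronglyMeasurable.measurable).aestronglyMeasurable
    · rw [Real.norm_eq_abs, abs_le]; exact ⟨hF2 s ω, hF1 s ω⟩
  have hIb : BddAbove (range fun s => ∫ ω, F s ω ∂P) := by
    refine ⟨Real.pi / 2, ?_⟩
    rintro _ ⟨s, rfl⟩
    calc ∫ ω, F s ω ∂P ≤ ∫ ω, Real.pi / 2 ∂P :=
          integral_mono (hFi s) (integrable_const _) (hF1 s)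
      _ = Real.pi / 2 := by simp
  have happ : ∀ k : ℕ, ∃ s, (⨆ s, ∫ ω, F s ω ∂P) - 1 / ((k : ℝ) + 1) < ∫ ω, F s ω ∂P := by
    intro k
    apply exists_lt_of_lt_ciSup
    have : 0 < 1 / ((k : ℝ) + 1) := by positivity
    linarith
  choose σ hσ using happ
  let s : ℕ → S := fun n => σ n.unpair.1 n.unpair.2
  have hle : ∀ k ω, F (σ k) ω ≤ F s ω := by
    intro k ω
    refine ciSup_le fun n => ?_
    have := le_ciSup (hbdd s ω) (Nat.pair k n)
    simpa [s] using this
  have hmax : (⨆ s, ∫ ω, F s ω ∂P) ≤ ∫ ω, F s ω ∂P := by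
    apply le_of_forall_pos_le_add
    intro ε hε
    obtain ⟨k, hk⟩ := exists_nat_one_div_lt hε
    have := integral_mono (hFi (σ k)) (hFi s) (hle k)
    linarith [hσ k]
  refine ⟨fun n => (s n).1, fun n => (s n).2, fun t ht => ?_⟩
  let s' : ℕ → S := fun n => Nat.casesOn n ⟨t, ht⟩ s
  have hle' : ∀ ω, F s ω ≤ F s' ω := fun ω =>
    ciSup_le fun n => le_ciSup (hbdd s' ω) (n + 1)
  have heq : ∫ ω, F s ω ∂P = ∫ ω, F s' ω ∂P :=
    le_antisymm (integral_mono (hFi _) (hFi _) hle') ((le_ciSup hIb s').trans hmax)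
  have := (integral_eq_iff_of_ae_le (hFi _) (hFi _) (Eventually.of_forall hle')).1 heq
  filter_upwards [this] with ω h
  change _ ≤ F s ω
  rw [h]
  exact le_ciSup (hbdd s' ω) 0

/-- If the countable subfamily is a.s. bounded, its supremum is the least upper bound. -/
theorem isLUB_of_seq [IsProbabilityMeasure P] (S : Set (Ω →ₘ[P] ℝ))
    (s : ℕ → Ω →ₘ[P] ℝ) (hs : ∀ n, s n ∈ S)
    (hsup : ∀ t ∈ S, ∀ᵐ ω ∂P, Real.arctan (t ω) ≤ ⨆ n, Real.arctan (s n ω))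
    (hb : ∀ᵐ ω ∂P, BddAbove (range fun n => s n ω)) : ∃ η, IsLUB S η := by
  have hm : Measurable fun ω => ⨆ n, s n ω :=
    Measurable.iSup fun n => (s n).stronglyMeasurable.measurable
  have hmk := AEEqFun.coeFn_mk (μ := P) _ hm.aestronglyMeasurable
  refine ⟨AEEqFun.mk _ hm.aestronglyMeasurable, ?_, ?_⟩
  · intro t ht
    rw [← AEEqFun.coeFn_le]
    filter_upwards [hmk, hsup t ht, hb] with ω h1 h2 h3
    rw [h1]
    refine Real.arctan_strictMono.le_iff_le.1 (h2.trans (ciSup_le fun n => ?_))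
    exact Real.arctan_strictMono.monotone (le_ciSup h3 n)
  · intro u hu
    rw [← AEEqFun.coeFn_le]
    have : ∀ᵐ ω ∂P, ∀ n, s n ω ≤ u ω := ae_all_iff.2 fun n => AEEqFun.coeFn_le.2 (hu (hs n))
    filter_upwards [hmk, this] with ω h1 h2
    rw [h1]
    exact ciSup_le h2

theorem exists_isLUB [IsProbabilityMeasure P] (S : Set (Ω →ₘ[P] ℝ)) (hS : S.Nonempty)
    (hb : BddAbove S) : ∃ η, IsLUB S η := by
  obtain ⟨s, hs, hsup⟩ := exists_seq_sup S hS
  refine isLUB_of_seq S s hs hsup ?_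
  obtain ⟨u, hu⟩ := hb
  have : ∀ᵐ ω ∂P, ∀ n, s n ω ≤ u ω := ae_all_iff.2 fun n => AEEqFun.coeFn_le.2 (hu (hs n))
  filter_upwards [this] with ω h
  exact ⟨u ω, by rintro _ ⟨n, rfl⟩; exact h n⟩

theorem isLUB_lsup [IsProbabilityMeasure P] (S : Set (Ω →ₘ[P] ℝ)) (hS : S.Nonempty)
    (hb : BddAbove S) : IsLUB S (lsup S) := by
  have h := exists_isLUB S hS hb
  rw [lsup, dif_pos h]
  exact h.choose_spec

theorem inter_nonempty_of_directed {G : Set (Ω →ₘ[P] B)} (hG : ConvexlyCompact G)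
    {ι : Type*} [Nonempty ι] (C : ι → Set (Ω →ₘ[P] B))
    (hC : ∀ i, (C i).Nonempty ∧ C i ⊆ G ∧ SeqClosed (C i) ∧ LConvex (C i))
    (hdir : ∀ i j, ∃ k, C k ⊆ C i ∧ C k ⊆ C j) : ∃ x, ∀ i, x ∈ C i := by
  have key : ∀ S : Finset (Set (Ω →ₘ[P] B)), (S : Set (Set (Ω →ₘ[P] B))) ⊆ range C →
      ∃ k, ∀ s ∈ S, C k ⊆ s := by
    intro S
    induction S using Finset.induction_on with
    | empty => intro _; exact ⟨Classical.arbitrary ι, by simp⟩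
    | insert a S ha ih =>
      intro h
      rw [Finset.coe_insert, insert_subset_iff] at h
      obtain ⟨i, hi⟩ := ih h.2
      obtain ⟨j, rfl⟩ := h.1
      obtain ⟨k, hk1, hk2⟩ := hdir i j
      refine ⟨k, fun s hs => ?_⟩
      rcases Finset.mem_insert.1 hs with rfl | hs
      · exact hk2
      · exact hk1.trans (hi s hs)
  obtain ⟨x, hx⟩ := hG.2.2.2 (range C) (by rintro _ ⟨i, rfl⟩; exact hC i) (by
    intro S hS
    obtain ⟨k, hk⟩ := key S hS
    obtain ⟨x, hx⟩ := (hC k).1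
    exact ⟨x, fun s hs => hk s hs hx⟩)
  exact ⟨x, fun i => hx _ ⟨i, rfl⟩⟩

theorem eval_meas {g : Ω → (B →L[ℝ] ℝ)} (hg : StronglyMeasurable g) {x : Ω → B}
    (hx : StronglyMeasurable x) : Measurable fun ω => g ω (x ω) :=
  ((isBoundedBilinearMap_apply (𝕜 := ℝ) (E := B) (F := ℝ)).continuous.comp_stronglyMeasurable
    (hg.prodMk hx)).measurable

theorem null_of_unbounded_functional [IsProbabilityMeasure P] {G : Set (Ω →ₘ[P] B)}
    (hG : ConvexlyCompact G) (g : Ω → (B →L[ℝ] ℝ)) (hg : StronglyMeasurable g)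
    (A : Set Ω) (x : ℕ → Ω →ₘ[P] B) (hx : ∀ n, x n ∈ G)
    (h : ∀ᵐ ω ∂P, ω ∈ A → ∀ k : ℕ, ∃ n, (k : ℝ) ≤ g ω (x n ω)) :
    ∀ᵐ ω ∂P, ω ∉ A := by
  let K : ℕ → Unit → Ω → Set B := fun k _ ω => {b | ω ∈ A → (k : ℝ) ≤ g ω b}
  have hK : ∀ k i ω, K k i ω = univ ∨ K k i ω = {b | (k : ℝ) ≤ g ω b} := by
    intro k i ω
    by_cases hω : ω ∈ A <;> simp [K, hω]
  have hcc := fun k => constraint_closed_convex hG.2.1 hG.2.2.1 (K k)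
    (fun i ω => by
      rcases hK k i ω with e | e <;> rw [e]
      · exact isClosed_univ
      · exact isClosed_le continuous_const (g ω).continuous)
    (fun i ω => by
      rcases hK k i ω with e | e <;> rw [e]
      · exact convex_univ
      · exact convex_halfSpace_ge (g ω).toLinearMap.isLinear _)
  obtain ⟨y, hy⟩ := inter_nonempty_of_directed hG
    (fun k : ℕ => {x ∈ G | ∀ i, ∀ᵐ ω ∂P, x ω ∈ K k i ω}) (fun k => by
      refine ⟨?_, fun z hz => hz.1, (hcc k).1, (hcc k).2⟩
      obtain ⟨z, hz, h2⟩ := select hG.2.1 hG.2.2.1 x hx (fun n => {ω | (k : ℝ) ≤ g ω (x n ω)})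
        (fun n => measurableSet_le measurable_const (eval_meas hg (x n).stronglyMeasurable))
      refine ⟨z, hz, fun _ => ?_⟩
      filter_upwards [h, h2] with ω h h2 hA
      obtain ⟨n, hn, e⟩ := h2 (h hA k)
      rw [e]; exact hn) (by
      intro i j
      refine ⟨max i j, ?_, ?_⟩
      · rintro z ⟨hz, h⟩
        refine ⟨hz, fun u => ?_⟩
        filter_upwards [h u] with ω h hA
        exact le_trans (by exact_mod_cast le_max_left i j) (h hA)
      · rintro z ⟨hz, h⟩
        refine ⟨hz, fun u => ?_⟩
        filter_upwards [h u] with ω h hA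
        exact le_trans (by exact_mod_cast le_max_right i j) (h hA))
  have : ∀ᵐ ω ∂P, ∀ k, y ω ∈ K k () ω := ae_all_iff.2 fun k => (hy k).2 ()
  filter_upwards [this] with ω h hA
  obtain ⟨k, hk⟩ := exists_nat_gt (g ω (y ω))
  exact absurd (h k hA) (not_le.2 hk)

/-- A measurable selection of almost norming functionals. -/
theorem exists_norming (x : Ω → B) (hx : StronglyMeasurable x) :
    ∃ f : Ω → (B →L[ℝ] ℝ), StronglyMeasurable f ∧ (∀ ω, ‖f ω‖ ≤ 1) ∧
      ∀ ω, ‖x ω‖ - 1 ≤ f ω (x ω) := by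
  choose d hd1 hd2 using fun b : B => exists_dual_vector'' ℝ b
  have hex : ∀ ω, ∃ n, dist (hx.approx n ω) (x ω) < 1 / 2 := fun ω =>
    ((Metric.tendsto_nhds.1 (hx.tendsto_approx ω)) (1 / 2) (by norm_num)).exists
  have hN : Measurable fun ω => Nat.find (hex ω) := measurable_find hex fun k =>
    measurableSet_lt ((hx.approx k).stronglyMeasurable.dist hx).measurable measurable_const
  let F : ℕ → Ω → (B →L[ℝ] ℝ) := fun n ω => d (hx.approx n ω)
  have hF : ∀ n, StronglyMeasurable (F n) := fun n =>
    ((hx.approx n).map d).stronglyMeasurable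
  refine ⟨fun ω => F (Nat.find (hex ω)) ω, ?_, fun ω => hd1 _, fun ω => ?_⟩
  · borelize (B →L[ℝ] ℝ)
    rw [stronglyMeasurable_iff_measurable_separable]
    constructor
    · exact Measurable.find (fun n => (hF n).measurable)
        (fun k => measurableSet_lt ((hx.approx k).stronglyMeasurable.dist hx).measurable
          measurable_const) hex
    · refine (TopologicalSpace.IsSeparable.iUnion
        fun n => (hF n).isSeparable_range).mono ?_
      rintro _ ⟨ω, rfl⟩
      exact mem_iUnion.2 ⟨_, ω, rfl⟩
  · have h := Nat.find_spec (hex ω)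
    set n := Nat.find (hex ω)
    set y := hx.approx n ω
    change _ ≤ d y (x ω)
    have h1 : d y (x ω) = ‖y‖ - d y (y - x ω) := by
      rw [map_sub, hd2 y]; simp
    have h2 : d y (y - x ω) ≤ ‖y - x ω‖ :=
      (le_abs_self _).trans (((d y).le_opNorm _).trans
        (mul_le_of_le_one_left (norm_nonneg _) (hd1 y)))
    rw [dist_eq_norm] at h
    have h3 : ‖x ω‖ ≤ ‖y‖ + ‖y - x ω‖ := by
      have := norm_sub_le y (y - x ω)
      simpa using this
    linarith

/-- Gliding hump sequence. -/
def hump (f : ℕ → (B →L[ℝ] ℝ)) (x : ℕ → B) : ℕ → (B →L[ℝ] ℝ)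
  | 0 => 0
  | n + 1 => hump f x n + (if 0 ≤ hump f x n (x n) then ((1 : ℝ) / 3) ^ n else -((1 : ℝ) / 3) ^ n) • f n

theorem hump_lim (f : ℕ → (B →L[ℝ] ℝ)) (x : ℕ → B) (hf : ∀ n, ‖f n‖ ≤ 1) :
    ∃ g, Tendsto (hump f x) atTop (nhds g) ∧
      ∀ n, 1 ≤ ‖x n‖ → ‖x n‖ - 1 ≤ f n (x n) → (1 / 3 : ℝ) ^ n * (‖x n‖ / 2 - 1) ≤ |g (x n)| := by
  have hu : ∀ n, dist (hump f x n) (hump f x (n + 1)) ≤ 1 * (1 / 3 : ℝ) ^ n := by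
    intro n
    rw [dist_eq_norm, hump, sub_add_cancel_left, norm_neg, norm_smul, one_mul]
    have : ‖(if 0 ≤ hump f x n (x n) then ((1 : ℝ) / 3) ^ n else -((1 : ℝ) / 3) ^ n)‖
        = (1 / 3 : ℝ) ^ n := by
      split_ifs <;> simp
    rw [this]
    exact mul_le_of_le_one_right (by positivity) (hf n)
  obtain ⟨g, hg⟩ := cauchySeq_tendsto_of_complete
    (cauchySeq_of_le_geometric _ _ (by norm_num) hu)
  refine ⟨g, hg, fun n hn hfn => ?_⟩
  have h1 := dist_le_of_le_geometric_of_tendsto _ _ (by norm_num) hu hg (n + 1)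
  have h2 : |(hump f x (n+1) - g) (x n)| ≤ ((1 / 3 : ℝ) ^ n / 2) * ‖x n‖ := by
    refine ((hump f x (n+1) - g).le_opNorm _).trans ?_
    gcongr
    rw [← dist_eq_norm]
    refine h1.trans (le_of_eq ?_)
    rw [pow_succ]; ring
  have h3 : (1 / 3 : ℝ) ^ n * (‖x n‖ - 1) ≤ |hump f x (n+1) (x n)| := by
    have hp : (0 : ℝ) < (1 / 3 : ℝ) ^ n := by positivity
    have hm : (1 / 3 : ℝ) ^ n * (‖x n‖ - 1) ≤ (1 / 3 : ℝ) ^ n * f n (x n) := by gcongr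
    rw [hump]
    split_ifs with h
    · refine le_trans ?_ (le_abs_self _)
      simp only [add_apply, smul_apply, smul_eq_mul]
      linarith
    · refine le_trans ?_ (neg_le_abs _)
      simp only [add_apply, smul_apply, smul_eq_mul]
      push Not at h
      linarith
  have h4 : |hump f x (n+1) (x n)| ≤ |(hump f x (n+1) - g) (x n)| + |g (x n)| := by
    have := abs_add_le ((hump f x (n+1) - g) (x n)) (g (x n))
    simpa using this
  nlinarith

theorem hump_meas (f : ℕ → Ω → (B →L[ℝ] ℝ)) (x : ℕ → Ω → B)
    (hf : ∀ n, StronglyMeasurable (f n)) (hx : ∀ n, StronglyMeasurable (x n)) (n : ℕ) :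
    StronglyMeasurable fun ω => hump (fun n => f n ω) (fun n => x n ω) n := by
  induction n with
  | zero => exact stronglyMeasurable_const
  | succ n ih =>
    simp only [hump]
    have hite : StronglyMeasurable fun ω =>
        if 0 ≤ hump (fun n => f n ω) (fun n => x n ω) n (x n ω) then ((1 : ℝ) / 3) ^ n
        else -((1 : ℝ) / 3) ^ n :=
      StronglyMeasurable.ite (measurableSet_le measurable_const (eval_meas ih (hx n)))
        stronglyMeasurable_const stronglyMeasurable_const
    exact ih.add (hite.smul (hf n))

/-- `L⁰`-convexly compact sets are a.s. bounded. -/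
theorem asBounded_of_convexlyCompact [IsProbabilityMeasure P] {G : Set (Ω →ₘ[P] B)}
    (hG : ConvexlyCompact G) : ASBounded G := by
  obtain ⟨s, hs, hsup⟩ := exists_seq_sup (nrm '' G) (hG.1.image _)
  choose w hw hws using hs
  let A : Set Ω := {ω | ∀ k : ℕ, ∃ n, (k : ℝ) ≤ ‖w n ω‖}
  -- norm-large elements on `A`
  have hbig : ∀ n : ℕ, ∃ y ∈ G, ∀ᵐ ω ∂P, ω ∈ A → 2 + 2 * 3 ^ n * (n : ℝ) ≤ ‖y ω‖ := by
    intro n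
    obtain ⟨z, hz, h2⟩ := select hG.2.1 hG.2.2.1 w hw
      (fun m => {ω | 2 + 2 * 3 ^ n * (n : ℝ) ≤ ‖w m ω‖})
      (fun m => measurableSet_le measurable_const (w m).stronglyMeasurable.norm.measurable)
    refine ⟨z, hz, ?_⟩
    filter_upwards [h2] with ω h2 hA
    obtain ⟨k, hk⟩ := exists_nat_ge (2 + 2 * 3 ^ n * (n : ℝ))
    obtain ⟨m, hm⟩ := hA k
    obtain ⟨m, hm, e⟩ := h2 ⟨m, hk.trans hm⟩
    rw [e]; exact hm
  choose y hy hyA using hbig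
  choose f hf hf1 hfy using fun n => exists_norming (y n) (y n).stronglyMeasurable
  choose g hgl hgb using fun ω => hump_lim (fun n => f n ω) (fun n => y n ω) (fun n => hf1 n ω)
  have hgm : StronglyMeasurable g := stronglyMeasurable_of_tendsto atTop
    (fun n => hump_meas f (fun n => y n) hf (fun n => (y n).stronglyMeasurable) n)
    (tendsto_pi_nhds.2 hgl)
  have hgy : ∀ᵐ ω ∂P, ω ∈ A → ∀ n : ℕ, (n : ℝ) ≤ |g ω (y n ω)| := by
    filter_upwards [ae_all_iff.2 hyA] with ω h hA n
    have h1 := h n hA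
    have hnn : (0 : ℝ) ≤ 2 * 3 ^ n * (n : ℝ) := by positivity
    refine le_trans ?_ (hgb ω n (by linarith) (hfy n ω))
    have h3 : (1 / 3 : ℝ) ^ n * 3 ^ n = 1 := by rw [← mul_pow]; norm_num
    have : (1 / 3 : ℝ) ^ n * (3 ^ n * n) ≤ (1 / 3 : ℝ) ^ n * (‖y n ω‖ / 2 - 1) := by
      gcongr; linarith
    rwa [← mul_assoc, h3, one_mul] at this
  -- split by sign
  have hA1 : ∀ᵐ ω ∂P, ω ∉ A ∩ {ω | ∀ k : ℕ, ∃ n, (k : ℝ) ≤ g ω (y n ω)} :=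
    null_of_unbounded_functional hG g hgm _ y hy (Eventually.of_forall fun ω h => h.2)
  have hA2 : ∀ᵐ ω ∂P, ω ∉ A ∩ {ω | ∀ k : ℕ, ∃ n, (k : ℝ) ≤ (-g) ω (y n ω)} :=
    null_of_unbounded_functional hG (-g) hgm.neg _ y hy (Eventually.of_forall fun ω h => h.2)
  have hA : ∀ᵐ ω ∂P, ω ∉ A := by
    filter_upwards [hA1, hA2, hgy] with ω h1 h2 h3 hA
    apply h2
    refine ⟨hA, fun k => ?_⟩
    by_contra hcon
    push Not at hcon
    apply h1
    refine ⟨hA, fun j => ⟨max j k, ?_⟩⟩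
    have h4 := h3 hA (max j k)
    have h5 := hcon (max j k)
    simp only [Pi.neg_apply, neg_apply] at h5
    have hj : (j : ℝ) ≤ ((max j k : ℕ) : ℝ) := by exact_mod_cast le_max_left j k
    have hk : (k : ℝ) ≤ ((max j k : ℕ) : ℝ) := by exact_mod_cast le_max_right j k
    rcases le_abs.1 h4 with h6 | h6
    · linarith
    · linarith
  obtain ⟨η, hη⟩ := isLUB_of_seq (nrm '' G) s (fun n => ⟨w n, hw n, hws n⟩) hsup (by
    have h2 : ∀ᵐ ω ∂P, ∀ n, s n ω = ‖w n ω‖ := ae_all_iff.2 fun n => by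
      rw [← hws n]; exact nrm_coe _
    filter_upwards [hA, h2] with ω hA h2
    simp only [A, mem_ofPred_eq, not_forall, not_exists, not_le] at hA
    obtain ⟨k, hk⟩ := hA
    refine ⟨k, ?_⟩
    rintro _ ⟨n, rfl⟩
    simpa [h2 n] using (hk n).le)
  exact ⟨η, fun h hh => hη.1 ⟨h, hh, rfl⟩⟩

theorem Rr_le_iff [IsProbabilityMeasure P] {H : Set (Ω →ₘ[P] B)} (hne : H.Nonempty)
    (hb : ASBounded H) (x : Ω →ₘ[P] B) (r : Ω →ₘ[P] ℝ) :
    Rr H x ≤ r ↔ ∀ y ∈ H, nrm (x - y) ≤ r := by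
  obtain ⟨ξ, hξ⟩ := hb
  have hl : IsLUB ((fun y => nrm (x - y)) '' H) (Rr H x) := by
    refine isLUB_lsup _ (hne.image _) ⟨nrm x + ξ, ?_⟩
    rintro _ ⟨y, hy, rfl⟩
    refine (nrm_sub_le_iff x y _).2 ?_
    filter_upwards [AEEqFun.coeFn_add (nrm x) ξ, nrm_coe x, nrm_coe y,
      AEEqFun.coeFn_le.2 (hξ y hy)] with ω h1 h2 h3 h4
    rw [h1, Pi.add_apply, h2]
    rw [h3] at h4
    exact (norm_sub_le _ _).trans (by linarith)
  rw [isLUB_le_iff hl]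
  constructor
  · intro h y hy
    exact h ⟨y, hy, rfl⟩
  · rintro h _ ⟨y, hy, rfl⟩
    exact h y hy

theorem Dd_isLUB [IsProbabilityMeasure P] {H : Set (Ω →ₘ[P] B)} (hne : H.Nonempty)
    (hb : ASBounded H) : IsLUB {ξ | ∃ x ∈ H, ∃ y ∈ H, ξ = nrm (x - y)} (Dd H) := by
  obtain ⟨ξ, hξ⟩ := hb
  obtain ⟨x, hx⟩ := hne
  refine isLUB_lsup _ ⟨_, x, hx, x, hx, rfl⟩ ⟨ξ + ξ, ?_⟩
  rintro _ ⟨x, hx, y, hy, rfl⟩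
  refine (nrm_sub_le_iff x y _).2 ?_
  filter_upwards [AEEqFun.coeFn_add ξ ξ, nrm_coe x, nrm_coe y, AEEqFun.coeFn_le.2 (hξ x hx),
    AEEqFun.coeFn_le.2 (hξ y hy)] with ω h1 h2 h3 h4 h5
  rw [h1, Pi.add_apply]
  rw [h2] at h4
  rw [h3] at h5
  exact (norm_sub_le _ _).trans (by linarith)

/-- Sets cut out by random balls. -/
theorem balls_closed_convex {H : Set (Ω →ₘ[P] B)} (hc : SeqClosed H) (hv : LConvex H)
    (Y : Set (Ω →ₘ[P] B)) (r : Ω →ₘ[P] ℝ) :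
    SeqClosed {z ∈ H | ∀ y ∈ Y, nrm (z - y) ≤ r} ∧ LConvex {z ∈ H | ∀ y ∈ Y, nrm (z - y) ≤ r} := by
  have h := constraint_closed_convex hc hv
    (fun (y : Y) ω => Metric.closedBall (y.1 ω) (r ω))
    (fun _ _ => Metric.isClosed_closedBall) (fun _ _ => convex_closedBall _ _)
  have e : {z ∈ H | ∀ y ∈ Y, nrm (z - y) ≤ r} =
      {z ∈ H | ∀ y : Y, ∀ᵐ ω ∂P, z ω ∈ Metric.closedBall (y.1 ω) (r ω)} := by
    ext z
    simp only [mem_ofPred_eq, nrm_sub_le_iff, Metric.mem_closedBall, dist_eq_norm, Subtype.forall]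
  rw [e]
  exact h

/-- The random Chebyshev center is nonempty, and its members minimize the radius. -/
theorem exists_center [IsProbabilityMeasure P] {G : Set (Ω →ₘ[P] B)} (hG : ConvexlyCompact G)
    (hb : ASBounded G) : ∃ c ∈ G, ∀ x ∈ G, Rr G c ≤ Rr G x := by
  have : Nonempty G := hG.1.to_subtype
  obtain ⟨c, hc⟩ := inter_nonempty_of_directed hG
    (fun x : G => {z ∈ G | ∀ y ∈ G, nrm (z - y) ≤ Rr G x.1})
    (fun x => ⟨⟨x.1, x.2, (Rr_le_iff hG.1 hb _ _).1 le_rfl⟩, fun z hz => hz.1,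
      balls_closed_convex hG.2.1 hG.2.2.1 G _⟩) (by
      intro i j
      obtain ⟨z, hz, h⟩ := two_concat hG.2.2.1 i.2 j.2
        (measurableSet_le (Rr G i.1).stronglyMeasurable.measurable
          (Rr G j.1).stronglyMeasurable.measurable)
      have hmin : ∀ y ∈ G, ∀ᵐ ω ∂P, ‖z ω - y ω‖ ≤ min (Rr G i.1 ω) (Rr G j.1 ω) := by
        intro y hy
        filter_upwards [h, (nrm_sub_le_iff _ _ _).1 ((Rr_le_iff hG.1 hb i.1 _).1 le_rfl y hy),
          (nrm_sub_le_iff _ _ _).1 ((Rr_le_iff hG.1 hb j.1 _).1 le_rfl y hy)] with ω h h1 h2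
        by_cases hω : Rr G i.1 ω ≤ Rr G j.1 ω
        · rw [h.1 hω, min_eq_left hω]; exact h1
        · rw [h.2 hω, min_eq_right (not_le.1 hω).le]; exact h2
      refine ⟨⟨z, hz⟩, ?_, ?_⟩
      · rintro v ⟨hv, hv2⟩
        refine ⟨hv, fun y hy => (hv2 y hy).trans ?_⟩
        refine (Rr_le_iff hG.1 hb _ _).2 fun y hy => (nrm_sub_le_iff _ _ _).2 ?_
        filter_upwards [hmin y hy] with ω h using h.trans (min_le_left _ _)
      · rintro v ⟨hv, hv2⟩
        refine ⟨hv, fun y hy => (hv2 y hy).trans ?_⟩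
        refine (Rr_le_iff hG.1 hb _ _).2 fun y hy => (nrm_sub_le_iff _ _ _).2 ?_
        filter_upwards [hmin y hy] with ω h using h.trans (min_le_right _ _))
  obtain ⟨x0, hx0⟩ := hG.1
  exact ⟨c, (hc ⟨x0, hx0⟩).1, fun x hx => (Rr_le_iff hG.1 hb _ _).2 (hc ⟨x, hx⟩).2⟩

theorem RrS_eq {G : Set (Ω →ₘ[P] B)} {c : Ω →ₘ[P] B} (hc : c ∈ G)
    (hmin : ∀ x ∈ G, Rr G c ≤ Rr G x) : RrS G G = Rr G c := by
  have hg : IsGLB ((fun x => Rr G x) '' G) (Rr G c) := by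
    refine ⟨?_, fun u hu => hu ⟨c, hc, rfl⟩⟩
    rintro _ ⟨x, hx, rfl⟩
    exact hmin x hx
  have h : ∃ ξ, IsGLB ((fun x => Rr G x) '' G) ξ := ⟨_, hg⟩
  rw [RrS, linf, dif_pos h]
  exact h.choose_spec.unique hg

/-- Random Kirk fixed point theorem, on an invariant closed `L⁰`-convex subset `A` of `G`. -/
theorem kirk [IsProbabilityMeasure P] {G : Set (Ω →ₘ[P] B)} (hG : ConvexlyCompact G)
    (hb : ASBounded G) (hns : RandNormalStructure G) (T : (Ω →ₘ[P] B) → (Ω →ₘ[P] B))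
    (hT : NonexpansiveOn G T) (A : Set (Ω →ₘ[P] B)) (hAG : A ⊆ G) (hne : A.Nonempty)
    (hAc : SeqClosed A) (hAv : LConvex A) (hTA : MapsTo T A A) : ∃ p ∈ A, T p = p := by
  obtain ⟨H, hHA, hmin⟩ := zorn_superset_nonempty
    {H | H.Nonempty ∧ H ⊆ G ∧ SeqClosed H ∧ LConvex H ∧ MapsTo T H H} (by
      intro c hc hch hcne
      have : Nonempty c := hcne.to_subtype
      refine ⟨⋂₀ c, ⟨?_, ?_, ?_, ?_, ?_⟩, fun s hs => sInter_subset_of_mem hs⟩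
      · obtain ⟨x, hx⟩ := inter_nonempty_of_directed hG (fun s : c => s.1)
          (fun s => ⟨(hc s.2).1, (hc s.2).2.1, (hc s.2).2.2.1, (hc s.2).2.2.2.1⟩) (by
            intro i j
            rcases hch.total i.2 j.2 with h | h
            · exact ⟨i, subset_rfl, h⟩
            · exact ⟨j, h, subset_rfl⟩)
        exact ⟨x, fun s hs => hx ⟨s, hs⟩⟩
      · obtain ⟨s, hs⟩ := hcne
        exact (sInter_subset_of_mem hs).trans (hc hs).2.1
      · intro x y hx hxy s hs
        exact (hc hs).2.2.1 x y (fun n => hx n s hs) hxy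
      · intro x hx y hy l h0 h1 s hs
        exact (hc hs).2.2.2.1 x (hx s hs) y (hy s hs) l h0 h1
      · intro x hx s hs
        exact (hc hs).2.2.2.2 (hx s hs)) A ⟨hne, hAG, hAc, hAv, hTA⟩
  obtain ⟨⟨hHne, hHG, hHc, hHv, hTH⟩, hm⟩ := hmin
  have hHb : ASBounded H := by
    obtain ⟨ξ, hξ⟩ := hb
    exact ⟨ξ, fun h hh => hξ h (hHG hh)⟩
  have hD := Dd_isLUB hHne hHb
  have hD0 : Dd H = 0 := by
    by_contra hD0
    obtain ⟨z, hz, hlt⟩ := hns H hHG hHne hHb hHc hHv hD0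
    -- the sublevel set of the radius is invariant, hence everything
    have hC : H ⊆ {w ∈ H | ∀ y ∈ H, nrm (w - y) ≤ Rr H z} := by
      refine hm ⟨⟨z, hz, (Rr_le_iff hHne hHb _ _).1 le_rfl⟩, fun w hw => hHG hw.1,
        (balls_closed_convex hHc hHv H _).1, (balls_closed_convex hHc hHv H _).2, ?_⟩
        (fun w hw => hw.1)
      rintro x ⟨hx, hxR⟩
      refine ⟨hTH hx, ?_⟩
      have hW : H ⊆ {w ∈ H | ∀ y ∈ ({T x} : Set (Ω →ₘ[P] B)), nrm (w - y) ≤ Rr H z} := by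
        have hTW : ∀ w ∈ H, T w ∈ {w ∈ H | ∀ y ∈ ({T x} : Set (Ω →ₘ[P] B)),
            nrm (w - y) ≤ Rr H z} := by
          intro w hw
          refine ⟨hTH hw, ?_⟩
          rintro y rfl
          refine (hT w (hHG hw) x (hHG hx)).trans ?_
          have := (nrm_sub_le_iff _ _ _).1 (hxR w hw)
          refine (nrm_sub_le_iff _ _ _).2 ?_
          filter_upwards [this] with ω h
          rwa [norm_sub_rev]
        exact hm ⟨⟨T z, hTW z hz⟩, fun w hw => hHG hw.1,
          (balls_closed_convex hHc hHv _ _).1, (balls_closed_convex hHc hHv _ _).2,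
          fun w hw => hTW w hw.1⟩ (fun w hw => hw.1)
      intro y hy
      have := (nrm_sub_le_iff _ _ _).1 ((hW hy).2 (T x) rfl)
      refine (nrm_sub_le_iff _ _ _).2 ?_
      filter_upwards [this] with ω h
      rwa [norm_sub_rev]
    have hle : Dd H ≤ Rr H z := by
      refine hD.2 ?_
      rintro _ ⟨x, hx, y, hy, rfl⟩
      exact (hC hx).2 y hy
    apply hD0
    apply le_antisymm
    · rw [← AEEqFun.coeFn_le]
      filter_upwards [hlt, AEEqFun.coeFn_le.2 hle,
        AEEqFun.coeFn_zero (α := Ω) (μ := P) (β := ℝ)] with ω h1 h2 h3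
      rw [h3]
      by_contra hcon
      exact absurd (h1 (not_le.1 hcon)) (not_lt.2 h2)
    · have h0 : nrm (z - z) ≤ Dd H := hD.1 ⟨z, hz, z, hz, rfl⟩
      rw [nrm_sub_le_iff] at h0
      rw [← AEEqFun.coeFn_le]
      filter_upwards [h0, AEEqFun.coeFn_zero (α := Ω) (μ := P) (β := ℝ)] with ω h1 h3
      rw [h3]
      exact (norm_nonneg _).trans h1
  obtain ⟨p, hp⟩ := hHne
  refine ⟨p, hHA hp, ?_⟩
  have h0 : nrm (T p - p) ≤ 0 := hD0 ▸ hD.1 ⟨T p, hTH hp, p, hp, rfl⟩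
  rw [nrm_sub_le_iff] at h0
  apply AEEqFun.ext
  filter_upwards [h0, AEEqFun.coeFn_zero (α := Ω) (μ := P) (β := ℝ)] with ω h1 h3
  rw [h3] at h1
  exact sub_eq_zero.1 (norm_le_zero_iff.1 h1)

theorem iso_ae {G : Set (Ω →ₘ[P] B)} {T : (Ω →ₘ[P] B) → (Ω →ₘ[P] B)} (hiso : IsometricOn G T)
    {x y : Ω →ₘ[P] B} (hx : x ∈ G) (hy : y ∈ G) :
    ∀ᵐ ω ∂P, ‖T x ω - T y ω‖ = ‖x ω - y ω‖ := by
  filter_upwards [nrm_sub_coe x y, nrm_sub_coe (T x) (T y)] with ω h1 h2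
  rw [← h1, ← h2, hiso x hx y hy]

/-- Every isometric self-mapping of an `L⁰`-convexly compact set with random normal
structure has a fixed point in the random Chebyshev center `C(G,G)`. -/
theorem fixed_point_of_isometric_in_randomChebCenter
    {Ω : Type*} [MeasurableSpace Ω] {P : Measure Ω} [IsProbabilityMeasure P]
    {B : Type*} [NormedAddCommGroup B] [NormedSpace ℝ B] [CompleteSpace B]
    (G : Set (Ω →ₘ[P] B)) (hG : ConvexlyCompact G) (hns : RandNormalStructure G)
    (T : (Ω →ₘ[P] B) → (Ω →ₘ[P] B)) (hmaps : Set.MapsTo T G G)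
    (hiso : IsometricOn G T) :
    ∃ x ∈ Cc G G, T x = x := by
  have hb := asBounded_of_convexlyCompact hG
  obtain ⟨c, hc, hmin⟩ := exists_center hG hb
  have hR := RrS_eq hc hmin
  have hit : ∀ n, ∀ y ∈ G, T^[n] y ∈ G := fun n y hy => hmaps.iterate n hy
  let K : G → Ω → Set B := fun y ω =>
    {b | ∀ ε > 0, ∀ᶠ n in atTop, ‖b - (T^[n] y.1) ω‖ ≤ Rr G c ω + ε}
  obtain ⟨hAc, hAv⟩ := constraint_closed_convex hG.2.1 hG.2.2.1 K
    (by
      intro y ω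
      refine isClosed_of_closure_subset fun b hb ε hε => ?_
      obtain ⟨b', hb', hd⟩ := Metric.mem_closure_iff.1 hb (ε / 2) (by positivity)
      filter_upwards [hb' (ε / 2) (by positivity)] with n hn
      rw [dist_eq_norm] at hd
      have := norm_add_le (b - b') (b' - (T^[n] y.1) ω)
      rw [sub_add_sub_cancel] at this
      linarith)
    (by
      intro y ω b hb b' hb' s t hs ht hst ε hε
      filter_upwards [hb ε hε, hb' ε hε] with n h1 h2
      have h3 : s • b + t • b' ∈ Metric.closedBall ((T^[n] y.1) ω) (Rr G c ω + ε) :=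
        convex_closedBall _ _ (by rwa [Metric.mem_closedBall, dist_eq_norm])
          (by rwa [Metric.mem_closedBall, dist_eq_norm]) hs ht hst
      rwa [Metric.mem_closedBall, dist_eq_norm] at h3)
  obtain ⟨p, ⟨hpG, hpA⟩, hTp⟩ := kirk hG hb hns T (fun x hx y hy => (hiso x hx y hy).le)
    {x ∈ G | ∀ y, ∀ᵐ ω ∂P, x ω ∈ K y ω} (fun x hx => hx.1)
    (by
      refine ⟨c, hc, fun y => ?_⟩
      have : ∀ᵐ ω ∂P, ∀ n, ‖c ω - (T^[n] y.1) ω‖ ≤ Rr G c ω := ae_all_iff.2 fun n =>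
        (nrm_sub_le_iff _ _ _).1 ((Rr_le_iff hG.1 hb c _).1 le_rfl _ (hit n _ y.2))
      filter_upwards [this] with ω h ε hε
      exact Eventually.of_forall fun n => (h n).trans (by linarith))
    hAc hAv
    (by
      rintro x ⟨hx, hxA⟩
      refine ⟨hmaps hx, fun y => ?_⟩
      have : ∀ᵐ ω ∂P, ∀ n, ‖T x ω - (T (T^[n] y.1)) ω‖ = ‖x ω - (T^[n] y.1) ω‖ :=
        ae_all_iff.2 fun n => iso_ae hiso hx (hit n _ y.2)
      filter_upwards [this, hxA y] with ω h h2 ε hε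
      have h4 := h2 ε hε
      rw [eventually_atTop] at h4 ⊢
      obtain ⟨N, hN⟩ := h4
      refine ⟨N + 1, fun m hm => ?_⟩
      obtain ⟨n, rfl⟩ : ∃ n, m = n + 1 := ⟨m - 1, by omega⟩
      have hn := hN n (by omega)
      rw [Function.iterate_succ_apply', h n]
      exact hn)
  refine ⟨p, ⟨hpG, ?_⟩, hTp⟩
  rw [hR]
  refine le_antisymm ((Rr_le_iff hG.1 hb _ _).2 fun y hy => (nrm_sub_le_iff _ _ _).2 ?_)
    (hmin p hpG)
  have : ∀ᵐ ω ∂P, ∀ n, ‖T p ω - (T (T^[n] y)) ω‖ = ‖p ω - (T^[n] y) ω‖ :=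
    ae_all_iff.2 fun n => iso_ae hiso hpG (hit n _ hy)
  filter_upwards [this, hpA ⟨y, hy⟩] with ω h h2
  rw [hTp] at h
  have h3 : ∀ n, ‖p ω - (T^[n] y) ω‖ = ‖p ω - y ω‖ := by
    intro n
    induction n with
    | zero => rfl
    | succ n ih => rw [Function.iterate_succ_apply', h n, ih]
  refine le_of_forall_pos_le_add fun ε hε => ?_
  obtain ⟨n, hn⟩ := (h2 ε hε).exists
  rw [← h3 n]
  exact hn

end RNM
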